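/- For every constant c > 0 there is a negligible function ν such that the following holds for every binary autoregressive process and all indices a ≤ b. Letting t_1, t_2, … be sampled from the process, the probability that simultaneously Σ_{i=a}^{b} H_e^i(t) > c·(b−a) and Σ_{i=a}^{b} min{1, H_e^i(t)} ≤ (c²/2)·(b−a) is at most ν(b−a). -/

import Mathlib

open Finset
open scoped Classical

noncomputable section

/-- `ν : ℕ → ℝ` is negligible if for every `k`, `ν N ≤ N⁻ᵏ` for all sufficiently large `N`. -/
def Negligible (ν : ℕ → ℝ) : Prop :=
  ∀ k : ℕ, ∃ N₀ : ℕ, ∀ N ≥ N₀, ν N ≤ 1 / (N : ℝ) ^ k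

/-- The empirical entropy `H_e^i(t)` of the `i`-th bit of the sequence `T` with respect to
the binary autoregressive process `p` (logarithms base 2). -/
def empEnt (p : (i : ℕ) → (Fin i → Bool) → ℝ) (T : ℕ → Bool) (i : ℕ) : ℝ :=
  if T i then -Real.logb 2 (p i (fun j => T j.1))
  else -Real.logb 2 (1 - p i (fun j => T j.1))

/-- The probability that the binary autoregressive process `p` produces the first `len`
bits of `T`. -/
def seqMass (p : (i : ℕ) → (Fin i → Bool) → ℝ) (T : ℕ → Bool) (len : ℕ) : ℝ :=
  ∏ i ∈ Finset.range len,
    (if T i then p i (fun j => T j.1) else 1 - p i (fun j => T j.1))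

/-- Extend a finite bitstring to `ℕ → Bool` by zeros. -/
def extBits {b : ℕ} (t : Fin b → Bool) : ℕ → Bool :=
  fun i => if h : i < b then t ⟨i, h⟩ else false

/-- One-step weighted mass. -/
def phiW (lam q : ℝ) : ℝ :=
  q * Real.exp (Real.log 2 * (-Real.logb 2 q / 2 - lam * min 1 (-Real.logb 2 q)))

lemma phiW_nonneg (lam : ℝ) {q : ℝ} (hq : 0 ≤ q) : 0 ≤ phiW lam q :=
  mul_nonneg hq (Real.exp_pos _).le

lemma log_two_mul_logb (q : ℝ) : Real.log 2 * Real.logb 2 q = Real.log q := by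
  have : Real.log 2 ≠ 0 := (Real.log_pos (by norm_num)).ne'
  unfold Real.logb
  field_simp

lemma mul_exp_half {q : ℝ} (hq : 0 < q) : q * Real.exp (-Real.log q / 2) = √q := by
  have h : q = Real.exp (Real.log q) := (Real.exp_log hq).symm
  rw [Real.sqrt_eq_rpow, Real.rpow_def_of_pos hq]
  nth_rewrite 1 [h]
  rw [← Real.exp_add]
  congr 1; ring

lemma phiW_zero {q : ℝ} (hq : 0 ≤ q) : phiW 0 q = √q := by
  rcases hq.eq_or_lt with h | h
  · subst h; simp [phiW]
  · rw [← mul_exp_half h, phiW]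
    have := log_two_mul_logb q
    congr 2; linarith

lemma phiW_small (lam : ℝ) {q : ℝ} (hq : 0 ≤ q) (h2 : q ≤ 1 / 2) :
    phiW lam q ≤ √q * Real.exp (-(lam * Real.log 2)) := by
  rcases hq.eq_or_lt with h | h
  · subst h; simp [phiW]
  · have hl := log_two_mul_logb q
    have h1 : 1 ≤ -Real.logb 2 q := by
      have : Real.logb 2 q ≤ Real.logb 2 (1/2) :=
        Real.logb_le_logb_of_le (by norm_num) h h2
      have h3 : Real.logb 2 (1/2) = -1 := by
        rw [one_div, Real.logb_inv, Real.logb_self_eq_one (by norm_num)]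
      linarith
    rw [← mul_exp_half h, phiW, min_eq_left h1, mul_assoc, ← Real.exp_add]
    apply le_of_eq
    congr 2
    linarith

lemma phiW_large {lam : ℝ} (hlam : 1 / 2 ≤ lam) {q : ℝ} (h2 : 1 / 2 ≤ q) (hq : q ≤ 1) :
    phiW lam q ≤ q := by
  have h : 0 < q := by linarith
  have h1 : -Real.logb 2 q ≤ 1 := by
    have : Real.logb 2 (1/2) ≤ Real.logb 2 q :=
      Real.logb_le_logb_of_le (by norm_num) (by norm_num) h2
    have h3 : Real.logb 2 (1/2) = -1 := by
      rw [one_div, Real.logb_inv, Real.logb_self_eq_one (by norm_num)]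
    linarith
  have h0 : Real.logb 2 q ≤ 0 := Real.logb_nonpos (by norm_num) h.le hq
  rw [phiW, min_eq_right h1]
  have hl : 0 < Real.log 2 := Real.log_pos (by norm_num)
  have : Real.exp (Real.log 2 * (-Real.logb 2 q / 2 - lam * -Real.logb 2 q)) ≤ 1 := by
    rw [Real.exp_le_one_iff]
    apply mul_nonpos_of_nonneg_of_nonpos hl.le
    nlinarith
  nlinarith

lemma phiW_sum_zero {q : ℝ} (hq : q ∈ Set.Icc (0 : ℝ) 1) :
    phiW 0 q + phiW 0 (1 - q) ≤ √2 := by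
  obtain ⟨h0, h1⟩ := hq
  rw [phiW_zero h0, phiW_zero (by linarith)]
  apply Real.le_sqrt_of_sq_le
  have e1 := Real.sq_sqrt h0
  have e2 := Real.sq_sqrt (show 0 ≤ 1 - q by linarith)
  nlinarith [sq_nonneg (√q - √(1 - q))]

lemma phiW_sum_aux {lam : ℝ} (hlam : 1 / 2 ≤ lam) {q : ℝ} (h0 : 0 ≤ q) (h1 : q ≤ 1 / 2) :
    phiW lam q + phiW lam (1 - q) ≤ 1 + Real.exp (-(2 * lam * Real.log 2)) / 4 := by
  have a1 := phiW_small lam h0 h1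
  have a2 := phiW_large hlam (q := 1 - q) (by linarith) (by linarith)
  have e1 := Real.sq_sqrt h0
  have e : Real.exp (-(2 * lam * Real.log 2)) = Real.exp (-(lam * Real.log 2)) ^ 2 := by
    rw [sq, ← Real.exp_add]; congr 1; ring
  rw [e]
  nlinarith [sq_nonneg (√q - Real.exp (-(lam * Real.log 2)) / 2)]

lemma phiW_sum {lam : ℝ} (hlam : 1 / 2 ≤ lam) {q : ℝ} (hq : q ∈ Set.Icc (0 : ℝ) 1) :
    phiW lam q + phiW lam (1 - q) ≤ 1 + Real.exp (-(2 * lam * Real.log 2)) / 4 := by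
  obtain ⟨h0, h1⟩ := hq
  rcases le_total q (1/2) with h | h
  · exact phiW_sum_aux hlam h0 h
  · have := phiW_sum_aux hlam (q := 1 - q) (by linarith) (by linarith)
    rw [sub_sub_cancel] at this
    linarith

lemma phiW_sum_c {c : ℝ} (hc : 0 < c) (hc1 : c ≤ 1) {q : ℝ} (hq : q ∈ Set.Icc (0 : ℝ) 1) :
    phiW (1 / (2 * c)) q + phiW (1 / (2 * c)) (1 - q) ≤ Real.exp (0.14 * c) := by
  have hlam : 1 / 2 ≤ 1 / (2 * c) := by
    apply one_div_le_one_div_of_le <;> linarith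
  refine (phiW_sum hlam hq).trans ?_
  have hx : 2 * (1 / (2 * c)) * Real.log 2 = Real.log 2 / c := by field_simp
  rw [hx, Real.exp_neg]
  have hl : 0.69 < Real.log 2 := by linarith [Real.log_two_gt_d9]
  have he : 2.7 < Real.exp 1 := by linarith [Real.exp_one_gt_d9]
  set y := Real.log 2 / c with hy
  have hyc : 0.69 / c ≤ y := by rw [hy]; gcongr
  have hy0 : 0 < 0.69 / c := by positivity
  have h1 : y ≤ Real.exp (y - 1) := by linarith [Real.add_one_le_exp (y - 1)]
  have h2 : Real.exp y = Real.exp (y - 1) * Real.exp 1 := by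
    rw [← Real.exp_add]; congr 1; ring
  have h3 : 1.8 / c ≤ Real.exp y := by
    rw [h2]
    have : 0.69 / c * 2.7 ≤ Real.exp (y - 1) * Real.exp 1 :=
      mul_le_mul (hyc.trans h1) he.le (by norm_num) (Real.exp_pos _).le
    refine le_trans ?_ this
    rw [div_mul_eq_mul_div]
    gcongr
    norm_num
  have h4 : (Real.exp y)⁻¹ ≤ (1.8 / c)⁻¹ := inv_anti₀ (by positivity) h3
  rw [inv_div] at h4
  have h5 := Real.add_one_le_exp (0.14 * c)
  have : c / 1.8 / 4 ≤ 0.14 * c := by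
    rw [div_div, div_le_iff₀ (by norm_num)]; nlinarith
  linarith

lemma extBits_snoc_lt {n : ℕ} (t : Fin n → Bool) (x : Bool) {i : ℕ} (h : i < n) :
    extBits (Fin.snoc (α := fun _ => Bool) t x) i = extBits t i := by
  simp [extBits, h, Fin.snoc, Nat.lt_succ_of_lt h]

lemma extBits_snoc_eq {n : ℕ} (t : Fin n → Bool) (x : Bool) :
    extBits (Fin.snoc (α := fun _ => Bool) t x) n = x := by
  simp [extBits, Fin.snoc]

lemma sum_prod_le (F : (i : ℕ) → (Fin i → Bool) → Bool → ℝ) (K : ℕ → ℝ)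
    (hF : ∀ i h x, 0 ≤ F i h x) (hK : ∀ i h, F i h true + F i h false ≤ K i) (n : ℕ) :
    ∑ t : Fin n → Bool, ∏ i ∈ Finset.range n, F i (fun j => extBits t j.1) (extBits t i)
      ≤ ∏ i ∈ Finset.range n, K i := by
  induction n with
  | zero => simp
  | succ n ih =>
    have hK0 : 0 ≤ K n := (add_nonneg (hF n (fun _ => true) true) (hF n _ false)).trans (hK n _)
    rw [← (Fin.snocEquiv (fun _ : Fin (n+1) => Bool)).sum_comp, Fintype.sum_prod_type, Finset.sum_comm,
      Finset.prod_range_succ]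
    refine le_trans ?_ (mul_le_mul_of_nonneg_right ih hK0)
    rw [Finset.sum_mul]
    apply Finset.sum_le_sum
    intro t _
    have key : ∀ x : Bool, ∏ i ∈ Finset.range (n+1),
        F i (fun j => extBits ((Fin.snocEquiv (fun _ : Fin (n+1) => Bool)) (x, t)) j.1)
          (extBits ((Fin.snocEquiv (fun _ : Fin (n+1) => Bool)) (x, t)) i)
        = (∏ i ∈ Finset.range n, F i (fun j => extBits t j.1) (extBits t i)) *
          F n (fun j => extBits t j.1) x := by
      intro x
      have e : (Fin.snocEquiv (fun _ : Fin (n+1) => Bool)) (x, t)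
        = Fin.snoc (α := fun _ => Bool) t x := rfl
      rw [e, Finset.prod_range_succ, extBits_snoc_eq]
      congr 1
      · apply Finset.prod_congr rfl
        intro i hi
        have hi := Finset.mem_range.1 hi
        rw [extBits_snoc_lt t x hi]
        congr 1
        funext j
        exact extBits_snoc_lt t x (j.2.trans hi)
      · congr 1
        funext j
        exact extBits_snoc_lt t x j.2
    rw [Fintype.sum_bool, key, key, ← mul_add]
    exact mul_le_mul_of_nonneg_left (hK n _) (Finset.prod_nonneg fun i _ => hF _ _ _)

lemma core (c lam K : ℝ) (hlam : 0 ≤ lam)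
    (hK : ∀ q ∈ Set.Icc (0 : ℝ) 1, phiW lam q + phiW lam (1 - q) ≤ K)
    (p : (i : ℕ) → (Fin i → Bool) → ℝ) (hp : ∀ i h, p i h ∈ Set.Icc (0 : ℝ) 1)
    (a b : ℕ) (hab : a ≤ b) :
    ∑ t : Fin (b + 1) → Bool,
            seqMass p (extBits t) (b + 1) *
              (if c * ((b - a : ℕ) : ℝ) < (∑ i ∈ Finset.Icc a b, empEnt p (extBits t) i) ∧
                  (∑ i ∈ Finset.Icc a b, min 1 (empEnt p (extBits t) i)) ≤
                    c ^ 2 / 2 * ((b - a : ℕ) : ℝ)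
               then 1 else 0)
          ≤ K ^ (b - a + 1) *
            Real.exp (-(Real.log 2 * (c / 2 - lam * (c ^ 2 / 2)) * ((b - a : ℕ) : ℝ))) := by
  have hl : 0 < Real.log 2 := Real.log_pos (by norm_num)
  set N : ℝ := ((b - a : ℕ) : ℝ) with hN
  set E := Real.exp (-(Real.log 2 * (c / 2 - lam * (c ^ 2 / 2)) * N)) with hE
  let Q : (i : ℕ) → (Fin i → Bool) → Bool → ℝ := fun i h x => if x then p i h else 1 - p i h
  have hQ : ∀ i h x, 0 ≤ Q i h x := by
    intro i h x
    have := hp i h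
    obtain ⟨h0, h1⟩ := this
    cases x <;> simp [Q] <;> linarith
  let F : (i : ℕ) → (Fin i → Bool) → Bool → ℝ := fun i h x =>
    if a ≤ i then phiW lam (Q i h x) else Q i h x
  have hmain := sum_prod_le F (fun i => if a ≤ i then K else 1)
    (by
      intro i h x
      simp only [F]
      split_ifs
      · exact phiW_nonneg _ (hQ i h x)
      · exact hQ i h x)
    (by
      intro i h
      simp only [F]
      split_ifs
      · simpa [Q] using hK _ (hp i h)
      · simp [Q]) (b + 1)
  have hfil : (Finset.range (b+1)).filter (fun i => a ≤ i) = Finset.Icc a b := by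
    ext i; simp; omega
  have hKp : ∏ i ∈ Finset.range (b+1), (if a ≤ i then K else 1) = K ^ (b - a + 1) := by
    rw [← Finset.prod_filter, hfil, Finset.prod_const, Nat.card_Icc]
    congr 1; omega
  rw [hKp] at hmain
  refine le_trans ?_ (mul_le_mul_of_nonneg_right hmain (Real.exp_pos _).le)
  rw [Finset.sum_mul]
  apply Finset.sum_le_sum
  intro t _
  set T := extBits t with hT
  have hent : ∀ i, empEnt p T i = -Real.logb 2 (Q i (fun j => T j.1) (T i)) := by
    intro i
    simp only [empEnt, Q]
    split_ifs <;> rfl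
  have hprod : ∏ i ∈ Finset.range (b+1), F i (fun j => T j.1) (T i)
      = seqMass p T (b+1) * Real.exp (Real.log 2 *
        ((∑ i ∈ Finset.Icc a b, empEnt p T i) / 2
          - lam * ∑ i ∈ Finset.Icc a b, min 1 (empEnt p T i))) := by
    rw [Finset.sum_div, Finset.mul_sum, ← Finset.sum_sub_distrib, Finset.mul_sum, Real.exp_sum,
      ← hfil, Finset.prod_filter, seqMass, ← Finset.prod_mul_distrib]
    apply Finset.prod_congr rfl
    intro i _
    rw [hent i]
    simp only [F, phiW]
    split_ifs with h1 h2 <;> simp_all [Q]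
  have hmass : 0 ≤ seqMass p T (b+1) :=
    Finset.prod_nonneg fun i _ => hQ i (fun j => T j.1) (T i)
  rw [hprod, mul_assoc]
  apply mul_le_mul_of_nonneg_left _ hmass
  split_ifs with h
  · rw [hE, ← Real.exp_add, Real.one_le_exp_iff]
    obtain ⟨h1, h2⟩ := h
    have h3 := mul_le_mul_of_nonneg_left h2 hlam
    have : 0 ≤ Real.log 2 * (((∑ i ∈ Finset.Icc a b, empEnt p T i) - c * N) / 2 +
        (lam * (c ^ 2 / 2 * N) - lam * ∑ i ∈ Finset.Icc a b, min 1 (empEnt p T i))) := by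
      apply mul_nonneg hl.le
      linarith
    linarith
  · positivity

lemma negligible_geom (C d : ℝ) (hC : 0 < C) (hd : 0 < d) :
    Negligible (fun N => C * Real.exp (-(d * (N : ℝ)))) := by
  intro k
  have hr : |Real.exp (-d)| < 1 := by
    rw [abs_of_pos (Real.exp_pos _), Real.exp_lt_one_iff]; linarith
  have ht := tendsto_pow_const_mul_const_pow_of_abs_lt_one k hr
  have hev := ht.eventually (gt_mem_nhds (show (0:ℝ) < 1 / C by positivity))
  obtain ⟨N₀, hN₀⟩ := Filter.eventually_atTop.1 hev
  refine ⟨max N₀ 1, fun N hN => ?_⟩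
  have h1 := hN₀ N (le_trans (le_max_left _ _) hN)
  have h2 : (0:ℝ) < N := by
    have : 1 ≤ N := le_trans (le_max_right _ _) hN
    exact_mod_cast this
  have e : Real.exp (-d) ^ N = Real.exp (-(d * (N : ℝ))) := by
    rw [← Real.exp_nat_mul]; congr 1; ring
  rw [e, lt_div_iff₀ hC] at h1
  rw [le_div_iff₀ (by positivity)]
  linarith

/-- For every constant `c > 0` there is a negligible `ν` such that for
every binary autoregressive process `p` and all indices `a ≤ b`: sampling the bits
`t₁, t₂, …` from the process, the probability that simultaneously
`Σ_{i=a}^{b} H_e^i(t) > c·(b−a)` and `Σ_{i=a}^{b} min{1, H_e^i(t)} ≤ (c²/2)·(b−a)` is at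
most `ν (b − a)`. -/
theorem stmt_15 (c : ℝ) (hc : 0 < c) :
    ∃ ν : ℕ → ℝ, Negligible ν ∧
      ∀ p : (i : ℕ) → (Fin i → Bool) → ℝ,
        (∀ i h, p i h ∈ Set.Icc (0 : ℝ) 1) →
        ∀ a b : ℕ, a ≤ b →
          ∑ t : Fin (b + 1) → Bool,
            seqMass p (extBits t) (b + 1) *
              (if c * ((b - a : ℕ) : ℝ) < (∑ i ∈ Finset.Icc a b, empEnt p (extBits t) i) ∧
                  (∑ i ∈ Finset.Icc a b, min 1 (empEnt p (extBits t) i)) ≤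
                    c ^ 2 / 2 * ((b - a : ℕ) : ℝ)
               then 1 else 0)
          ≤ ν (b - a) := by
  have hl : 0.69 < Real.log 2 := by linarith [Real.log_two_gt_d9]
  rcases le_or_gt c 1 with hc1 | hc1
  · refine ⟨_, negligible_geom (Real.exp (0.14 * c)) (0.03 * c) (Real.exp_pos _) (by positivity),
      fun p hp a b hab => ?_⟩
    refine (core c (1 / (2 * c)) (Real.exp (0.14 * c)) (by positivity)
      (fun q hq => phiW_sum_c hc hc1 hq) p hp a b hab).trans ?_
    have e : c / 2 - 1 / (2 * c) * (c ^ 2 / 2) = c / 4 := by field_simp; ring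
    rw [e, ← Real.exp_nat_mul, ← Real.exp_add, ← Real.exp_add, Real.exp_le_exp]
    push_cast
    have h0 : (0:ℝ) ≤ c * ((b - a : ℕ) : ℝ) := by positivity
    nlinarith
  · refine ⟨_, negligible_geom (√2) (Real.log 2 * (c - 1) / 2) (by positivity)
      (by have : 0 < c - 1 := by linarith
          positivity), fun p hp a b hab => ?_⟩
    refine (core c 0 (√2) le_rfl (fun q hq => phiW_sum_zero hq) p hp a b hab).trans ?_
    have e : √2 = Real.exp (Real.log 2 / 2) := by
      rw [Real.sqrt_eq_rpow, Real.rpow_def_of_pos (by norm_num)]; congr 1; ring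
    rw [e, ← Real.exp_nat_mul, ← Real.exp_add, ← Real.exp_add, Real.exp_le_exp]
    push_cast
    apply le_of_eq
    ring

end
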